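/- Consider the extended acyclic causal model M = (S, F, κ) with binary endogenous variables A (Assassin does not put poison in the coffee), B (Bodyguard puts antidote in the coffee), and VS (Victim survives), where the values of A and B are determined directly by the exogenous context, VS satisfies the structural equation VS = max(A, B), and the ranking function κ satisfies κ(s) > κ(s_{u⃗}) for every world s in which A = 0, where u⃗ is the context in which A = 1 and B = 1 and s_{u⃗} is the world determined by u⃗. Then B = 1 is not a cause of VS = 1 in the extended model M and context u⃗. -/

import Mathlib

open scoped Classical

/-- A causal model: for each endogenous variable `X`, a structural equation `F X`
computing the value of `X` from the values of the exogenous variables and of the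
(other) endogenous variables. -/
structure CausalModel (U : Type) (RU : U → Type) (V : Type) (R : V → Type) where
  F : (X : V) → ((u : U) → RU u) → ((Y : V) → R Y) → R X

/-- A context: an assignment of values to the exogenous variables. -/
def Ctx (U : Type) (RU : U → Type) : Type := (u : U) → RU u

/-- A world: an assignment of values to the endogenous variables. -/
def World (V : Type) (R : V → Type) : Type := (X : V) → R X

variable {U : Type} {RU : U → Type} {V : Type} {R : V → Type}

/-- `v` is a solution of the structural equations of `M` in context `u`. -/
def Solves (M : CausalModel U RU V R) (u : Ctx U RU) (v : World V R) : Prop :=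
  ∀ X, v X = M.F X u v

/-- `M` is acyclic: there is a strict total order on the endogenous variables such
that `F X` does not depend on the value of `Y` unless `Y ≺ X`. -/
def CausalModel.Acyclic (M : CausalModel U RU V R) : Prop :=
  ∃ lt : V → V → Prop, IsStrictTotalOrder V lt ∧
    ∀ X Y : V, ¬ lt Y X →
      ∀ (u : Ctx U RU) (v : World V R) (y : R Y),
        M.F X u (Function.update v Y y) = M.F X u v

/-- A partial assignment of values to endogenous variables (an intervention). -/
def PAssign (V : Type) (R : V → Type) : Type := (X : V) → Option (R X)

/-- The partial assignment setting the variables in `A` to the values given by `w`. -/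
noncomputable def restrictTo (A : Set V) (w : World V R) : PAssign V R :=
  fun X => if X ∈ A then some (w X) else none

/-- Combination of partial assignments, with priority to the first. -/
def PAssign.union (g h : PAssign V R) : PAssign V R :=
  fun X => (g X).orElse (fun _ => h X)

/-- The partial assignment setting the single variable `X` to `x`. -/
noncomputable def PAssign.single (X : V) (x : R X) : PAssign V R :=
  fun Y => if h : X = Y then some (h ▸ x) else none

/-- The intervened model `M_{g}`: variables in the domain of `g` get the constant
equation given by `g`; the others keep their equation from `M`. -/
def intervene (M : CausalModel U RU V R) (g : PAssign V R) : CausalModel U RU V R where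
  F := fun X u v => (g X).elim (M.F X u v) id

/-- Causal formulas: primitive events `X = x`, Boolean combinations, and
intervention formulas `[Y⃗ ← y⃗]φ`. -/
inductive CForm (V : Type) (R : V → Type) : Type where
  | prim (X : V) (x : R X)
  | neg (φ : CForm V R)
  | conj (φ ψ : CForm V R)
  | intv (g : PAssign V R) (φ : CForm V R)

/-- A formula is an event if it is a Boolean combination of primitive events
(no interventions). -/
def CForm.IsEvent : CForm V R → Prop
  | .prim _ _ => True
  | .neg φ => φ.IsEvent
  | .conj φ ψ => φ.IsEvent ∧ ψ.IsEvent
  | .intv _ _ => False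

/-- The endogenous variables mentioned in a formula. -/
def CForm.vars : CForm V R → Set V
  | .prim X _ => {X}
  | .neg φ => φ.vars
  | .conj φ ψ => φ.vars ∪ ψ.vars
  | .intv g φ => {X | g X ≠ none} ∪ φ.vars

/-- Satisfaction of causal formulas: `(M,u) ⊨ X = x` iff `X` has value `x` in the
(unique, for acyclic models) solution; `(M,u) ⊨ [g]φ` iff `(M_g, u) ⊨ φ`. -/
def Sat : CausalModel U RU V R → Ctx U RU → CForm V R → Prop
  | M, u, .prim X x => ∃ v, Solves M u v ∧ v X = x
  | M, u, .neg φ => ¬ Sat M u φ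
  | M, u, .conj φ ψ => Sat M u φ ∧ Sat M u ψ
  | M, u, .intv g φ => Sat (intervene M g) u φ

/-- AC1 and AC2 of the (updated) HP definition, with witnesses `W, w, xs'`:
`X⃗ = x⃗` (given by the set `Xs` of variables and values `xs`) is a weak cause of
`φ` in `(M,u)`. -/
def WeakCause (M : CausalModel U RU V R) (u : Ctx U RU)
    (Xs : Finset V) (xs : World V R) (φ : CForm V R)
    (W : Set V) (w : World V R) (xs' : World V R) : Prop :=
  -- AC1
  (∀ X ∈ Xs, Sat M u (.prim X (xs X))) ∧ Sat M u φ ∧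
  -- AC2: X⃗ is included in Z⃗ = Wᶜ
  Disjoint (↑Xs : Set V) W ∧
  ∀ zs : World V R, (∀ Z ∈ Wᶜ, Sat M u (.prim Z (zs Z))) →
    -- AC2(a)
    (Sat M u (.intv ((restrictTo (↑Xs) xs').union (restrictTo W w)) (.neg φ)) ∧
    -- AC2(b)
    ∀ W' ⊆ W, ∀ Z' ⊆ Wᶜ,
      Sat M u (.intv (((restrictTo (↑Xs) xs).union (restrictTo W' w)).union
        (restrictTo Z' zs)) φ))

/-- The (updated) HP definition of actual cause: AC1, AC2 (for some witness), and
the minimality condition AC3. -/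
def ActualCause (M : CausalModel U RU V R) (u : Ctx U RU)
    (Xs : Finset V) (xs : World V R) (φ : CForm V R) : Prop :=
  (∃ W w xs', WeakCause M u Xs xs φ W w xs') ∧
  ∀ Ys : Finset V, Ys ⊂ Xs → ¬ ∃ W w xs', WeakCause M u Ys xs φ W w xs'

/-- AC1 and AC2 for an extended causal model `(M, κ)` with witnesses `W, w, xs'`:
in addition to the HP conditions, in AC2(a) there must be a world `s₀` with
`κ s₀ ≤ κ s_{u⃗}` at which `X⃗ = x⃗' ∧ W⃗ = w⃗` is true (where `s_{u⃗}` is the world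
determined by the context `u⃗`, i.e. the solution). -/
def ExtWeakCause {U : Type} {RU : U → Type} {V : Type} {R : V → Type}
    (M : CausalModel U RU V R) (κ : World V R → ℕ∞) (u : Ctx U RU)
    (Xs : Finset V) (xs : World V R) (φ : CForm V R)
    (W : Set V) (w : World V R) (xs' : World V R) : Prop :=
  WeakCause M u Xs xs φ W w xs' ∧
  ∀ vsol : World V R, Solves M u vsol →
    ∃ s₀ : World V R, κ s₀ ≤ κ vsol ∧
      (∀ X ∈ Xs, s₀ X = xs' X) ∧ (∀ Y ∈ W, s₀ Y = w Y)

/-- Cause in an extended causal model `(M, κ)` and context `u⃗`. -/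
def ExtActualCause {U : Type} {RU : U → Type} {V : Type} {R : V → Type}
    (M : CausalModel U RU V R) (κ : World V R → ℕ∞) (u : Ctx U RU)
    (Xs : Finset V) (xs : World V R) (φ : CForm V R) : Prop :=
  (∃ W w xs', ExtWeakCause M κ u Xs xs φ W w xs') ∧
  ∀ Ys : Finset V, Ys ⊂ Xs → ¬ ∃ W w xs', ExtWeakCause M κ u Ys xs φ W w xs'

/-- The endogenous variables of the assassin/bodyguard example:
`A` = Assassin does not put poison in the coffee, `B` = Bodyguard puts antidote in
the coffee, `VS` = Victim survives. -/
inductive PoisonVar : Type where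
  | A | B | VS
deriving DecidableEq

/-- The causal model: the exogenous context (a pair of Booleans) directly
determines `A` and `B`, and `VS = max(A, B)`. -/
def poisonModel : CausalModel Unit (fun _ => Bool × Bool) PoisonVar (fun _ => Bool) where
  F := fun X u v =>
    match X with
    | .A => (u ()).1
    | .B => (u ()).2
    | .VS => v .A || v .B

/-- The context in which `A = 1` and `B = 1`. -/
def poisonCtx : Ctx Unit (fun _ => Bool × Bool) := fun _ => (true, true)

/-- The world in which every variable has value `1` solves the poison model in the context
`A = 1`, `B = 1`. -/
theorem solves_poisonModel_true :
    Solves poisonModel poisonCtx (fun _ => true) := by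
  rintro (_ | _ | _) <;> rfl

/-- if the ranking function `κ` gives every world in which `A = 0` a
strictly higher rank than the world `s_{u⃗}` determined by the context `u⃗` (in
which `A = 1` and `B = 1`), then `B = 1` is not a cause of `VS = 1` in the
extended model `(M, κ)` and context `u⃗`. -/
theorem bodyguard_not_ext_cause
    (κ : World PoisonVar (fun _ => Bool) → ℕ∞)
    (hκ : ∀ vsol : World PoisonVar (fun _ => Bool), Solves poisonModel poisonCtx vsol →
      ∀ s : World PoisonVar (fun _ => Bool), s PoisonVar.A = false → κ vsol < κ s) :
    ¬ ExtActualCause poisonModel κ poisonCtx {PoisonVar.B} (fun _ => true)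
      (.prim PoisonVar.VS true) := by
  rintro ⟨⟨W, w, xs', ⟨-, -, hdisj, hAC2⟩, hnormal⟩, -⟩
  have hB : PoisonVar.B ∉ W := by simpa using hdisj
  obtain ⟨ha, hb⟩ := hAC2 (fun _ => true) fun _ _ => ⟨_, solves_poisonModel_true, rfl⟩
  have hA : PoisonVar.A ∈ W → w PoisonVar.A = true := by
    intro hAW
    obtain ⟨s, hs, -, hsW⟩ := hnormal _ solves_poisonModel_true
    by_contra h
    have hsA : s PoisonVar.A = false := (hsW _ hAW).trans (Bool.eq_false_of_not_eq_true h)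
    exact absurd (hκ _ solves_poisonModel_true s hsA) hs.not_gt
  have hVS : PoisonVar.VS ∈ W → w PoisonVar.VS = true := by
    intro hVW
    obtain ⟨v, hv, hvVS⟩ := hb W subset_rfl ∅ (Set.empty_subset _)
    have h := hv PoisonVar.VS
    simp only [intervene, PAssign.union, restrictTo] at h
    simpa [hVW, hvVS] using h
  refine ha ⟨fun X => if X = PoisonVar.B then xs' X else true, ?_, by simp⟩
  rintro (_ | _ | _)
  · by_cases h : PoisonVar.A ∈ W <;>
      simp [intervene, PAssign.union, restrictTo, poisonModel, poisonCtx, h, hA]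
  · simp [intervene, PAssign.union, restrictTo]
  · by_cases h : PoisonVar.VS ∈ W <;>
      simp [intervene, PAssign.union, restrictTo, poisonModel, h, hVS]
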